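/- For every access control matrix M for a finite entity set E, there exists a domain and type enforcement policy DTP = (D, T, δ, τ, tbl) that enforces M with |D| = r(M) and |T| = c(M); consequently this policy minimizes max(|D|, |T|) over all domain and type enforcement policies enforcing M. -/

import Mathlib

/-- The number of equivalence classes induced by a relation `r` on `E`:
the cardinality of the set of classes `{ {v | r u v} : u ∈ E }`. -/
noncomputable def numClasses {E : Type*} (r : E → E → Prop) : ℕ :=
  Nat.card (Set.range fun u => {v | r u v})

/-- Row equivalence `u ≡_row v` for an access control matrix `M`:
`M[u,a,x] = M[v,a,x]` for every `x` and `a`. -/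
def rowEquiv {E A : Type*} (M : E → A → E → Bool) (u v : E) : Prop :=
  ∀ a : A, ∀ x : E, M u a x = M v a x

/-- Column equivalence `u ≡_col v` for an access control matrix `M`:
`M[x,a,u] = M[x,a,v]` for every `x` and `a`. -/
def colEquiv {E A : Type*} (M : E → A → E → Bool) (u v : E) : Prop :=
  ∀ a : A, ∀ x : E, M x a u = M x a v

/-- Indistinguishability `u ≡ v` for an access control matrix `M`: for every
`a`, the four entries `M[u,a,u]`, `M[u,a,v]`, `M[v,a,u]`, `M[v,a,v]` are all
`1` or all `0`, and for every `x ∉ {u,v}`, `M[u,a,x] = M[v,a,x]` and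
`M[x,a,u] = M[x,a,v]`. -/
def indistM {E A : Type*} (M : E → A → E → Bool) (u v : E) : Prop :=
  ∀ a : A,
    ((M u a u = true ∧ M u a v = true ∧ M v a u = true ∧ M v a v = true) ∨
     (M u a u = false ∧ M u a v = false ∧ M v a u = false ∧ M v a v = false)) ∧
    ∀ x : E, x ≠ u → x ≠ v → (M u a x = M v a x ∧ M x a u = M x a v)

/-- A domain and type enforcement policy `(D, T, δ, τ, tbl)` enforces `M`:
for every `u, v ∈ E` and `a ∈ Σ`, `M[u,a,v] = 1` iff `tbl[δ(u), a, τ(v)] = 1`. -/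
def EnforcesDTE {E A D T : Type*} (M : E → A → E → Bool)
    (δ : E → D) (τ : E → T) (tbl : D → A → T → Bool) : Prop :=
  ∀ u v : E, ∀ a : A, (M u a v = true ↔ tbl (δ u) a (τ v) = true)

universe v w

theorem numClasses_le_aux {E : Type*} {D' : Type*} [Finite D'] (r : E → E → Prop) (f : E → D')
    (h : ∀ u v, f u = f v → {x | r u x} = {x | r v x}) : numClasses r ≤ Nat.card D' := by
  unfold numClasses
  refine Nat.card_le_card_of_injective (fun c => f c.2.choose) ?_
  intro c d hcd
  have h1 := h _ _ hcd
  have hc := c.2.choose_spec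
  have hd := d.2.choose_spec
  apply Subtype.ext
  rw [← hc, ← hd]
  exact h1

theorem exists_classes_aux {E : Type*} [Finite E] (r : E → E → Prop) (hr : ∀ u, r u u) :
    ∃ (δ : E → Fin (numClasses r)) (p : Fin (numClasses r) → E), ∀ u, r (p (δ u)) u := by
  let e : Set.range (fun u => {v | r u v}) ≃ Fin (numClasses r) := Finite.equivFin _
  refine ⟨fun u => e ⟨_, u, rfl⟩, fun d => (e.symm d).2.choose, fun u => ?_⟩
  have h := (e.symm (e ⟨{v | r u v}, u, rfl⟩)).2.choose_spec
  have h2 : u ∈ (e.symm (e ⟨{v | r u v}, u, rfl⟩)).1 := by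
    rw [Equiv.symm_apply_apply]
    exact hr u
  rw [← h] at h2
  exact h2

/-- Every access control matrix `M` over a finite entity set
is enforced by some domain and type enforcement policy with `|D| = r(M)` and
`|T| = c(M)`; consequently this policy minimizes `max(|D|, |T|)` over all
domain and type enforcement policies enforcing `M`. -/
theorem exists_min_dte_policy {E A : Type*} [Finite E] [Finite A]
    (M : E → A → E → Bool) :
    ∃ (D T : Type) (_ : Finite D) (_ : Finite T)
      (δ : E → D) (τ : E → T) (tbl : D → A → T → Bool),
      EnforcesDTE M δ τ tbl ∧
      Nat.card D = numClasses (rowEquiv M) ∧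
      Nat.card T = numClasses (colEquiv M) ∧
      ∀ (D' : Type v) (T' : Type w), Finite D' → Finite T' →
        ∀ (δ' : E → D') (τ' : E → T') (tbl' : D' → A → T' → Bool),
          EnforcesDTE M δ' τ' tbl' →
          max (Nat.card D) (Nat.card T) ≤ max (Nat.card D') (Nat.card T') := by
  obtain ⟨δ, p, hp⟩ := exists_classes_aux (rowEquiv M) (fun u a x => rfl)
  obtain ⟨τ, q, hq⟩ := exists_classes_aux (colEquiv M) (fun u a x => rfl)
  refine ⟨Fin (numClasses (rowEquiv M)), Fin (numClasses (colEquiv M)), inferInstance,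
    inferInstance, δ, τ, fun d a t => M (p d) a (q t), ?_, Nat.card_fin _, Nat.card_fin _, ?_⟩
  · intro u v a
    beta_reduce
    rw [hp u a, hq v a]
  · intro D' T' _ _ δ' τ' tbl' h
    have hM : ∀ u a v, M u a v = tbl' (δ' u) a (τ' v) := fun u a v =>
      Bool.eq_iff_iff.mpr (h u v a)
    rw [Nat.card_fin, Nat.card_fin]
    refine max_le_max (numClasses_le_aux _ δ' ?_) (numClasses_le_aux _ τ' ?_)
    · intro u v huv
      ext x
      simp only [rowEquiv, Set.mem_ofPred_eq, hM, huv]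
    · intro u v huv
      ext x
      simp only [colEquiv, Set.mem_ofPred_eq, hM, huv]
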